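/- Let n, m, n', m' be positive integers with n + m = n' + m' and let μ, μ' > 0. If f is a biholomorphism from the Fock–Bargmann–Hartogs domain D_{n,m}(μ) onto D_{n',m'}(μ'), then f maps the slice 𝒱 = {(z,0) : z ∈ ℂ^n} ⊆ D_{n,m}(μ) onto the slice 𝒱' = {(z',0) : z' ∈ ℂ^{n'}} ⊆ D_{n',m'}(μ'); in particular, for every z ∈ ℂ^n the last m' coordinates of f(z,0) vanish. -/

import Mathlib

/-- The Fock–Bargmann–Hartogs domain
`D_{n,m}(μ) = {(z,w) ∈ ℂ^n × ℂ^m : ‖w‖² < exp (−μ‖z‖²)}`. -/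
def FBH (n m : ℕ) (μ : ℝ) :
    Set (EuclideanSpace ℂ (Fin n) × EuclideanSpace ℂ (Fin m)) :=
  {p | ‖p.2‖ ^ 2 < Real.exp (-μ * ‖p.1‖ ^ 2)}

theorem FBH_zero_mem (n m : ℕ) (μ : ℝ) (z : EuclideanSpace ℂ (Fin n)) :
    ((z, 0) : EuclideanSpace ℂ (Fin n) × EuclideanSpace ℂ (Fin m)) ∈ FBH n m μ := by
  simp [FBH, Real.exp_pos]

theorem FBH_isOpen (n m : ℕ) (μ : ℝ) : IsOpen (FBH n m μ) := by
  unfold FBH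
  exact isOpen_lt (by fun_prop) (by fun_prop)

theorem FBH_slice_aux
    (n m n' m' : ℕ) (hn : 0 < n) (μ μ' : ℝ) (hμ' : 0 < μ')
    (f : EuclideanSpace ℂ (Fin n) × EuclideanSpace ℂ (Fin m) →
      EuclideanSpace ℂ (Fin n') × EuclideanSpace ℂ (Fin m'))
    (g : EuclideanSpace ℂ (Fin n') × EuclideanSpace ℂ (Fin m') →
      EuclideanSpace ℂ (Fin n) × EuclideanSpace ℂ (Fin m))
    (hf : DifferentiableOn ℂ f (FBH n m μ))
    (hfmaps : Set.MapsTo f (FBH n m μ) (FBH n' m' μ'))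
    (hgf : ∀ x ∈ FBH n m μ, g (f x) = x) (z : EuclideanSpace ℂ (Fin n)) :
    (f (z, 0)).2 = 0 := by
  have hd : Differentiable ℂ (fun z : EuclideanSpace ℂ (Fin n) => f (z, 0)) := by
    intro z
    have h1 : DifferentiableAt ℂ f (z, 0) :=
      hf.differentiableAt ((FBH_isOpen n m μ).mem_nhds (FBH_zero_mem n m μ z))
    have h2 : DifferentiableAt ℂ (fun z : EuclideanSpace ℂ (Fin n) =>
      ((z, 0) : EuclideanSpace ℂ (Fin n) × EuclideanSpace ℂ (Fin m))) z := by fun_prop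
    exact DifferentiableAt.comp z h1 h2
  have hlt : ∀ z, ‖(f (z, 0)).2‖ ^ 2 < Real.exp (-μ' * ‖(f (z, 0)).1‖ ^ 2) :=
    fun z => hfmaps (FBH_zero_mem n m μ z)
  -- the last coordinates are bounded, hence constant
  have hb2 : Bornology.IsBounded (Set.range fun z => (f (z, 0)).2) := by
    refine isBounded_iff_forall_norm_le.2 ⟨1, ?_⟩
    rintro _ ⟨z, rfl⟩
    have h := hlt z
    have h1 : Real.exp (-μ' * ‖(f (z, 0)).1‖ ^ 2) ≤ 1 :=
      Real.exp_le_one_iff.2 (by nlinarith [sq_nonneg ‖(f (z, 0)).1‖])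
    exact (sq_le_one_iff₀ (norm_nonneg _)).1 (h.le.trans h1)
  have hc : ∀ a b, (f (a, 0)).2 = (f (b, 0)).2 :=
    fun a b => hd.snd.apply_eq_apply_of_bounded hb2 a b
  by_contra hne
  have hpos : 0 < ‖(f (z, 0)).2‖ ^ 2 := by positivity
  -- if the constant is nonzero, the first coordinates are bounded too
  have hb1 : Bornology.IsBounded (Set.range fun z => (f (z, 0)).1) := by
    refine isBounded_iff_forall_norm_le.2
      ⟨√(-Real.log (‖(f (z, 0)).2‖ ^ 2) / μ'), ?_⟩
    rintro _ ⟨a, rfl⟩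
    have h := hlt a
    rw [hc a z] at h
    have h1 := (Real.log_lt_iff_lt_exp hpos).2 h
    apply Real.le_sqrt_of_sq_le
    rw [le_div_iff₀ hμ']
    linarith
  have hc1 : ∀ a b, (f (a, 0)).1 = (f (b, 0)).1 :=
    fun a b => hd.fst.apply_eq_apply_of_bounded hb1 a b
  haveI : Nonempty (Fin n) := ⟨⟨0, hn⟩⟩
  obtain ⟨a, b, hab⟩ := exists_pair_ne (EuclideanSpace ℂ (Fin n))
  have h : f (a, 0) = f (b, 0) := Prod.ext (hc1 a b) (hc a b)
  have h2 := congrArg g h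
  rw [hgf _ (FBH_zero_mem n m μ a), hgf _ (FBH_zero_mem n m μ b)] at h2
  exact hab (congrArg Prod.fst h2)

/-- A biholomorphism between equidimensional Fock–Bargmann–Hartogs domains maps
the slice `𝒱 = {(z,0)}` onto the slice `𝒱' = {(z',0)}`; in particular the last
`m'` coordinates of `f(z,0)` vanish for every `z ∈ ℂ^n`. -/
theorem biholomorphism_maps_slice_onto_slice
    (n m n' m' : ℕ) (hn : 0 < n) (hm : 0 < m) (hn' : 0 < n') (hm' : 0 < m')
    (hdim : n + m = n' + m') (μ μ' : ℝ) (hμ : 0 < μ) (hμ' : 0 < μ')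
    (f : EuclideanSpace ℂ (Fin n) × EuclideanSpace ℂ (Fin m) →
      EuclideanSpace ℂ (Fin n') × EuclideanSpace ℂ (Fin m'))
    (g : EuclideanSpace ℂ (Fin n') × EuclideanSpace ℂ (Fin m') →
      EuclideanSpace ℂ (Fin n) × EuclideanSpace ℂ (Fin m))
    (hf : DifferentiableOn ℂ f (FBH n m μ))
    (hg : DifferentiableOn ℂ g (FBH n' m' μ'))
    (hfmaps : Set.MapsTo f (FBH n m μ) (FBH n' m' μ'))
    (hgmaps : Set.MapsTo g (FBH n' m' μ') (FBH n m μ))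
    (hgf : ∀ x ∈ FBH n m μ, g (f x) = x)
    (hfg : ∀ y ∈ FBH n' m' μ', f (g y) = y) :
    f '' {p : EuclideanSpace ℂ (Fin n) × EuclideanSpace ℂ (Fin m) | p.2 = 0} =
      {q : EuclideanSpace ℂ (Fin n') × EuclideanSpace ℂ (Fin m') | q.2 = 0} ∧
    ∀ z : EuclideanSpace ℂ (Fin n), (f (z, 0)).2 = 0 := by
  have hF := FBH_slice_aux n m n' m' hn μ μ' hμ' f g hf hfmaps hgf
  have hG := FBH_slice_aux n' m' n m hn' μ' μ hμ g f hg hgmaps hfg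
  refine ⟨?_, hF⟩
  ext ⟨u, v⟩
  constructor
  · rintro ⟨⟨z, w⟩, hw, h⟩
    have hw' : w = 0 := hw
    subst hw'
    rw [← h]
    exact hF z
  · intro hv
    have hv' : v = 0 := hv
    subst hv'
    exact ⟨g (u, 0), hG u, hfg _ (FBH_zero_mem n' m' μ' u)⟩
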